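/- Let (Δ,Θ) be a directive bi-sequence with associated prefixes (w_n), let n ≥ 0, and suppose |w_{n+1}| = 2|w_n| + 2, Assumption A does not hold for (w_n, w_{n+1}), and an image of w_n occurs in w_{n+1} at position 1 or at position 2. Then there exist pairwise distinct letters i, j, k ∈ {0,1,2} and an integer l ≥ 1 such that the pair (w_{n+1}, w_n), together with the pseudopalindromic prefixes missed between w_n and w_{n+1}, is given by one of the following rows (each row listing w_{n+1}; w_n; the missed prefixes): (i^l j^l; i^{l−1}; i^l), ((ij)^l(ki)^l; (ij)^{l−1}i; (ij)^l if l ≥ 2, and ij and ijk if l = 1), ((ij)^l ik(jk)^l; (ij)^l; (ij)^l i), (ijjkkiijjk; ijjk; ijjkki and ijjkkiij), (ijjkki; ij; ijjk), (ijjiij; ij; ijji), ((ijkj)^l(ikij)^l; (ijkj)^{l−1}ijk; (ijkj)^l i), ((ijkj)^l ijki(kjki)^l; (ijkj)^l i; (ijkj)^l ijk). Here u^l denotes the l-fold concatenation of u and juxtaposition denotes concatenation. -/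

import Mathlib

/-- The ternary alphabet. -/
abbrev Letter := Fin 3

/-- Finite words over the ternary alphabet. -/
abbrev Word := List Letter

/-- The four involutory antimorphisms of ternary words: the reversal `R`
and, for each letter `i`, the antimorphism `E i`. -/
inductive AM where
  | R : AM
  | E : Letter → AM
deriving DecidableEq

/-- The action of an antimorphism on a single letter: `R` fixes every letter,
and `E i` fixes `i` and exchanges the other two letters (in `Fin 3`,
this involution is `a ↦ -(i + a)`). -/
def AM.letter : AM → Letter → Letter
  | .R, _a => _a
  | .E i, a => -(i + a)

/-- The action of an antimorphism on a word: letterwise image followed by reversal. -/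
def AM.apply (t : AM) (w : Word) : Word := (w.map t.letter).reverse

/-- A word is a pseudopalindrome if it is a `ϑ`-palindrome for some
`ϑ ∈ {R, E_0, E_1, E_2}`. -/
def IsPseudopal (w : Word) : Prop := ∃ t : AM, t.apply w = w

/-- `v` is an image of `w` if `v = ϑ(w)` for some `ϑ ∈ {R, E_0, E_1, E_2}`. -/
def IsImage (w v : Word) : Prop := ∃ t : AM, v = t.apply w

/-- `v` is the `ϑ`-palindromic closure of `u`: the shortest `ϑ`-palindrome
having `u` as a prefix. -/
def IsPalClosure (t : AM) (u v : Word) : Prop :=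
  u <+: v ∧ t.apply v = v ∧
    ∀ v' : Word, u <+: v' → t.apply v' = v' → v.length ≤ v'.length

/-- `w` is the sequence of prefixes associated with the directive bi-sequence
`(Δ, Θ)`: `w 0 = ε` and `w (n+1) = (w n · δ_{n+1})^{ϑ_{n+1}}`. -/
def DirectivePrefixes (Δ : ℕ → Letter) (Θ : ℕ → AM) (w : ℕ → Word) : Prop :=
  w 0 = [] ∧ ∀ n : ℕ, IsPalClosure (Θ (n + 1)) (w n ++ [Δ (n + 1)]) (w (n + 1))

/-- A pseudopalindromic prefix `v` of `w_{n+1}` is missed between `w_n` and `w_{n+1}`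
if `|w_n| < |v| < |w_{n+1}|`. -/
def MissedBetween (wn wn1 v : Word) : Prop :=
  v <+: wn1 ∧ IsPseudopal v ∧ wn.length < v.length ∧ v.length < wn1.length

/-- An image of `u` occurs in `v` at (0-indexed) position `p`. -/
def OccursImageAt (u v : Word) (p : ℕ) : Prop :=
  p + u.length ≤ v.length ∧ IsImage u ((v.drop p).take u.length)

/-- Assumption A for the pair `(wn, wn1)`: some image of `wn` occurs in `wn1`
at a position `p` with `0 < p < |wn1| - |wn|`, overlapping both the prefix
occurrence of `wn` and the suffix occurrence of an image of `wn`. -/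
def AssumptionA (wn wn1 : Word) : Prop :=
  ∃ p : ℕ, 0 < p ∧ p < wn1.length - wn.length ∧ p < wn.length ∧
    wn1.length - wn.length < p + wn.length ∧ OccursImageAt wn wn1 p

/-- The prefix of length `n` of the directive bi-sequence is normalized:
every pseudopalindromic prefix of `w n` equals `w k` for some `k ≤ n`. -/
def NormalizedUpTo (w : ℕ → Word) (n : ℕ) : Prop :=
  ∀ v : Word, v <+: w n → IsPseudopal v → ∃ k : ℕ, k ≤ n ∧ v = w k

/-- `rep u l` is the `l`-fold concatenation `u^l`. -/
def rep (u : Word) (l : ℕ) : Word := (List.replicate l u).flatten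

/-- `rmSuf x y` is `x · y⁻¹`: the word `x` with its suffix of length `|y|` removed. -/
def rmSuf (x y : Word) : Word := x.take (x.length - y.length)

/-- `v` is a prefix of the infinite periodic word `pat^ω`. -/
def IsPrefixOfPow (pat v : Word) : Prop :=
  ∀ q : ℕ, ∀ hq : q < v.length, ∃ hp : q % pat.length < pat.length,
    v.get ⟨q, hq⟩ = pat.get ⟨q % pat.length, hp⟩

/-! ### Letters -/

theorem AM.letter_letter (t : AM) (a : Letter) : t.letter (t.letter a) = a := by
  cases t with
  | R => rfl
  | E i => simp [AM.letter]

theorem AM.letter_injective (t : AM) : Function.Injective t.letter :=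
  Function.LeftInverse.injective t.letter_letter

theorem AM.letter_third (t : AM) {a c : Letter} (ha : t.letter a ≠ a) (hc : c ≠ a)
    (hc' : c ≠ t.letter a) : t.letter c = c := by
  cases t with
  | R => exact absurd rfl ha
  | E i => revert i a c; decide

theorem AM.letter_E {i j k : Letter} (hij : i ≠ j) (hjk : j ≠ k) (hik : i ≠ k) :
    (AM.E k).letter i = j ∧ (AM.E k).letter j = i ∧ (AM.E k).letter k = k := by
  revert i j k; decide

theorem Letter.exists_third {i j : Letter} (h : i ≠ j) : ∃ k : Letter, j ≠ k ∧ i ≠ k := by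
  revert i j; decide

theorem Letter.eq_or_eq_or_eq {i j k : Letter} (hij : i ≠ j) (hjk : j ≠ k) (hik : i ≠ k)
    (a : Letter) : a = i ∨ a = j ∨ a = k := by
  revert i j k a; decide

/-! ### Words as segments of a sequence of letters -/

/-- The word `f s, f (s + 1), …, f (s + n - 1)`. -/
def seg (f : ℕ → Letter) (s n : ℕ) : Word := (List.range' s n).map f

@[simp]
theorem length_seg (f : ℕ → Letter) (s n : ℕ) : (seg f s n).length = n := by
  simp [seg]

theorem seg_add (f : ℕ → Letter) (s a b : ℕ) :
    seg f s (a + b) = seg f s a ++ seg f (s + a) b := by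
  simp [seg, ← List.map_append, List.range'_append_1]

theorem rep_succ (x : Word) (l : ℕ) : rep x (l + 1) = rep x l ++ x := by
  simp [rep, List.replicate_succ']

theorem seg_eq_rep {f : ℕ → Letter} {x : Word} {s d : ℕ} {l : ℕ}
    (h : ∀ q < l, seg f (s + q * d) d = x) : seg f s (l * d) = rep x l := by
  induction l with
  | zero => simp [seg, rep]
  | succ l ih =>
    rw [Nat.succ_mul, seg_add, ih fun q hq => h q (by omega), h l (by omega), rep_succ]

theorem seg_one (f : ℕ → Letter) (s : ℕ) : seg f s 1 = [f s] := rfl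

theorem seg_two (f : ℕ → Letter) (s : ℕ) : seg f s 2 = [f s, f (s + 1)] := rfl

theorem seg_three (f : ℕ → Letter) (s : ℕ) : seg f s 3 = [f s, f (s + 1), f (s + 2)] := rfl

theorem seg_four (f : ℕ → Letter) (s : ℕ) :
    seg f s 4 = [f s, f (s + 1), f (s + 2), f (s + 3)] := rfl

theorem take_seg (f : ℕ → Letter) {a n : ℕ} (h : a ≤ n) : (seg f 0 n).take a = seg f 0 a := by
  obtain ⟨b, rfl⟩ := Nat.exists_eq_add_of_le h
  rw [seg_add, List.take_left' (length_seg f 0 a)]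

theorem prefix_seg_iff (f : ℕ → Letter) (n : ℕ) (v : Word) :
    v <+: seg f 0 n ↔ v.length ≤ n ∧ v = seg f 0 v.length := by
  rw [List.prefix_iff_eq_take]
  constructor
  · intro h
    have hl : v.length ≤ n := by
      have := congrArg List.length h
      simp at this
      exact this
    exact ⟨hl, by rwa [take_seg f hl] at h⟩
  · rintro ⟨hl, h⟩
    rwa [take_seg f hl]

theorem eq_seg_getD (v : Word) : v = seg (fun q => v.getD q 0) 0 v.length := by
  apply List.ext_getElem
  · simp
  · intro q h _
    simp [seg, h]

theorem getElem_seg (f : ℕ → Letter) (s n q : ℕ) (h : q < (seg f s n).length) :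
    (seg f s n)[q] = f (s + q) := by
  simp [seg]

theorem apply_seg_eq_seg_iff (t : AM) (f : ℕ → Letter) (r s n : ℕ) :
    t.apply (seg f r n) = seg f s n ↔
      ∀ a b : ℕ, a + b + 1 = n → f (s + b) = t.letter (f (r + a)) := by
  constructor
  · intro h a b hab
    have hb : b < (t.apply (seg f r n)).length := by simp [AM.apply]; omega
    have h' := List.getElem_of_eq h hb
    have : n - 1 - b = a := by omega
    simpa [AM.apply, getElem_seg, this] using h'.symm
  · intro h
    apply List.ext_getElem
    · simp [AM.apply]
    · intro b h1 h2
      have hb : b < n := by simpa using h2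
      have := h (n - 1 - b) b (by omega)
      simpa [AM.apply, getElem_seg] using this.symm

/-- The prefix of length `p` of the sequence `f` is a pseudopalindrome. -/
def PalPrefix (f : ℕ → Letter) (p : ℕ) : Prop :=
  ∃ t : AM, ∀ a b : ℕ, a + b + 1 = p → f b = t.letter (f a)

theorem isPseudopal_seg_iff (f : ℕ → Letter) (p : ℕ) :
    IsPseudopal (seg f 0 p) ↔ PalPrefix f p := by
  simp [IsPseudopal, PalPrefix, apply_seg_eq_seg_iff]

/-- If the prefix of length `m` of `f` is a pseudopalindrome with an image at position `s`, then
going down by `s` in the sequence acts by an injective letter map. -/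
theorem exists_shift_of_occursImageAt {f : ℕ → Letter} {m N s : ℕ} (hp : PalPrefix f m)
    (h : OccursImageAt (seg f 0 m) (seg f 0 N) s) :
    ∃ r : Letter → Letter, Function.Injective r ∧ ∀ q < m, f q = r (f (q + s)) := by
  obtain ⟨t, ht⟩ := hp
  obtain ⟨hl, t', ht'⟩ := h
  simp only [length_seg] at hl ht'
  have hd : ((seg f 0 N).drop s).take m = seg f s m := by
    obtain ⟨b, rfl⟩ := Nat.exists_eq_add_of_le hl
    rw [seg_add, seg_add, List.append_assoc, List.drop_left' (length_seg f 0 s),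
      List.take_left' (length_seg _ _ _), Nat.zero_add]
  rw [hd] at ht'
  have h2 := (apply_seg_eq_seg_iff _ _ _ _ _).1 ht'.symm
  refine ⟨fun a => t.letter (t'.letter a), t.letter_injective.comp t'.letter_injective, ?_⟩
  intro q hq
  have e1 := h2 (m - 1 - q) q (by omega)
  have e2 := ht (m - 1 - q) q (by omega)
  simp only [Nat.zero_add] at e1
  simp only [Nat.add_comm q s, e1, t'.letter_letter, ← e2]

theorem occursImageAt_of_palPrefix {f : ℕ → Letter} {m N p : ℕ} (hm : m ≤ p) (hN : p ≤ N)
    (hp : PalPrefix f p) : OccursImageAt (seg f 0 m) (seg f 0 N) (p - m) := by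
  obtain ⟨t, ht⟩ := hp
  refine ⟨by simp; omega, t, ?_⟩
  have hd : ((seg f 0 N).drop (p - m)).take m = seg f (p - m) m := by
    obtain ⟨b, rfl⟩ := Nat.exists_eq_add_of_le (show p - m + m ≤ N by omega)
    rw [seg_add, seg_add, List.append_assoc, List.drop_left' (length_seg f 0 _),
      List.take_left' (length_seg _ _ _), Nat.zero_add]
  rw [length_seg, hd, eq_comm, apply_seg_eq_seg_iff]
  intro a b hab
  exact ht _ _ (by omega)

/-! ### Closures of full length -/

/-- The prefix of length `2 * m + 2` of `f` is the `θ`-palindromic closure of the prefix of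
length `m + 1`, the prefix of length `m` is a pseudopalindrome, and there are no pseudopalindromic
prefixes of length strictly between `m + 2` and `2 * m`. -/
structure FullClosure (f : ℕ → Letter) (m : ℕ) (θ : AM) : Prop where
  mirror : ∀ a b : ℕ, a + b = 2 * m + 1 → f b = θ.letter (f a)
  palPrefix : PalPrefix f m
  minimal : ∀ r ≤ m, ∃ a b : ℕ, a + b = m + r ∧ r ≤ a ∧ r ≤ b ∧ f b ≠ θ.letter (f a)
  gap : ∀ p : ℕ, m + 2 < p → p < 2 * m → ¬ PalPrefix f p

theorem isPseudopal_prefix {Δ : ℕ → Letter} {Θ : ℕ → AM} {w : ℕ → Word}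
    (hw : DirectivePrefixes Δ Θ w) (n : ℕ) : IsPseudopal (w n) := by
  cases n with
  | zero => exact ⟨.R, by simp [hw.1, AM.apply]⟩
  | succ n => exact ⟨_, (hw.2 n).2.1⟩

theorem not_apply_eq_of_isPalClosure {t : AM} {x y v : Word}
    (h : IsPalClosure t (x ++ y) v) (hy : t.apply y = y) :
    v.length ≤ 2 * x.length + y.length := by
  have := h.2.2 (x ++ y ++ t.apply x) (List.prefix_append _ _) (by
    have hx : t.apply (t.apply x) = x := by
      simp [AM.apply, Function.comp_def, AM.letter_letter]
    have happ : ∀ a b : Word, t.apply (a ++ b) = t.apply b ++ t.apply a := by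
      intro a b; simp [AM.apply]
    rw [happ, happ, hx, hy, List.append_assoc])
  simp [AM.apply] at this
  omega

theorem fullClosure_of_isPalClosure {f : ℕ → Letter} {m : ℕ} {θ : AM}
    (hp : PalPrefix f m) (hc : IsPalClosure θ (seg f 0 (m + 1)) (seg f 0 (2 * m + 2)))
    (hA : ¬ AssumptionA (seg f 0 m) (seg f 0 (2 * m + 2))) : FullClosure f m θ where
  mirror a b hab := by
    have := (apply_seg_eq_seg_iff _ _ _ _ _).1 hc.2.1 a b (by omega)
    simpa using this
  palPrefix := hp
  minimal r hr := by
    by_contra! hcon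
    have hsplit : seg f 0 (m + 1) = seg f 0 r ++ seg f r (m + 1 - r) := by
      have := seg_add f 0 r (m + 1 - r)
      rwa [Nat.zero_add, Nat.add_sub_cancel' (by omega)] at this
    rw [hsplit] at hc
    have := not_apply_eq_of_isPalClosure hc ((apply_seg_eq_seg_iff _ _ _ _ _).2
      fun a b hab => hcon _ _ (by omega) (by omega) (by omega))
    simp at this
    omega
  gap p h1 h2 hpp := hA ⟨p - m, by omega, by simp; omega, by simp; omega, by simp; omega,
    occursImageAt_of_palPrefix (by omega) (by omega) hpp⟩

section Missed

variable {f : ℕ → Letter} {m : ℕ} {θ : AM}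

theorem missedBetween_seg_iff (f : ℕ → Letter) (m : ℕ) (v : Word) :
    MissedBetween (seg f 0 m) (seg f 0 (2 * m + 2)) v ↔
      ∃ p : ℕ, m < p ∧ p < 2 * m + 2 ∧ PalPrefix f p ∧ v = seg f 0 p := by
  constructor
  · rintro ⟨h1, h2, h3, h4⟩
    rw [prefix_seg_iff] at h1
    rw [h1.2, isPseudopal_seg_iff] at h2
    simp only [length_seg] at h3 h4
    exact ⟨v.length, h3, h4, h2, h1.2⟩
  · rintro ⟨p, h1, h2, h3, rfl⟩
    refine ⟨?_, (isPseudopal_seg_iff f p).2 h3, by simpa using h1, by simpa using h2⟩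
    rw [prefix_seg_iff]
    simp
    omega

theorem FullClosure.length_cases (h : FullClosure f m θ) {p : ℕ} (h1 : m < p)
    (h2 : p < 2 * m + 2) (hp : PalPrefix f p) :
    p = m + 1 ∨ p = m + 2 ∨ p = 2 * m ∨ p = 2 * m + 1 := by
  by_contra hcon
  exact h.gap p (by omega) (by omega) hp

theorem FullClosure.missed_iff_eq (h : FullClosure f m θ) {p₀ : ℕ} (h1 : m < p₀)
    (h2 : p₀ < 2 * m + 2) (hp₀ : PalPrefix f p₀)
    (huniq : ∀ p, (p = m + 1 ∨ p = m + 2 ∨ p = 2 * m ∨ p = 2 * m + 1) → m < p → p < 2 * m + 2 →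
      PalPrefix f p → p = p₀) (v : Word) :
    MissedBetween (seg f 0 m) (seg f 0 (2 * m + 2)) v ↔ v = seg f 0 p₀ := by
  rw [missedBetween_seg_iff]
  constructor
  · rintro ⟨p, a, b, c, rfl⟩
    rw [huniq p (h.length_cases a b c) a b c]
  · rintro rfl
    exact ⟨p₀, h1, h2, hp₀, rfl⟩

end Missed

/-- The list of possible forms of the pair `(u, v)` together with the missed prefixes. -/
def SpecialForm (u v : Word) : Prop :=
  ∃ i j k : Letter, i ≠ j ∧ j ≠ k ∧ i ≠ k ∧ ∃ l : ℕ, 1 ≤ l ∧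
    ((v = rep [i] l ++ rep [j] l ∧ u = rep [i] (l - 1) ∧
      (∀ x : Word, MissedBetween u v x ↔ x = rep [i] l)) ∨
     (v = rep [i, j] l ++ rep [k, i] l ∧ u = rep [i, j] (l - 1) ++ [i] ∧
      (2 ≤ l → ∀ x : Word, MissedBetween u v x ↔ x = rep [i, j] l) ∧
      (l = 1 → ∀ x : Word, MissedBetween u v x ↔ (x = [i, j] ∨ x = [i, j, k]))) ∨
     (v = rep [i, j] l ++ [i, k] ++ rep [j, k] l ∧ u = rep [i, j] l ∧
      (∀ x : Word, MissedBetween u v x ↔ x = rep [i, j] l ++ [i])) ∨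
     (v = [i, j, j, k, k, i, i, j, j, k] ∧ u = [i, j, j, k] ∧
      (∀ x : Word, MissedBetween u v x ↔
        (x = [i, j, j, k, k, i] ∨ x = [i, j, j, k, k, i, i, j]))) ∨
     (v = [i, j, j, k, k, i] ∧ u = [i, j] ∧
      (∀ x : Word, MissedBetween u v x ↔ x = [i, j, j, k])) ∨
     (v = [i, j, j, i, i, j] ∧ u = [i, j] ∧
      (∀ x : Word, MissedBetween u v x ↔ x = [i, j, j, i])) ∨
     (v = rep [i, j, k, j] l ++ rep [i, k, i, j] l ∧
      u = rep [i, j, k, j] (l - 1) ++ [i, j, k] ∧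
      (∀ x : Word, MissedBetween u v x ↔ x = rep [i, j, k, j] l ++ [i])) ∨
     (v = rep [i, j, k, j] l ++ [i, j, k, i] ++ rep [k, j, k, i] l ∧
      u = rep [i, j, k, j] l ++ [i] ∧
      (∀ x : Word, MissedBetween u v x ↔ x = rep [i, j, k, j] l ++ [i, j, k])))

section Rows

variable {f : ℕ → Letter} {m : ℕ} {θ : AM} {i j k : Letter}

theorem letter_eq_of_mirror {t : AM} {N a b : ℕ} {x y : Letter}
    (ht : ∀ a b : ℕ, a + b + 1 = N → f b = t.letter (f a)) (hab : a + b + 1 = N)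
    (ha : f a = x) (hb : f b = y) : t.letter x = y := by
  rw [← ha, ← hb, ht a b hab]

theorem FullClosure.specialForm_of_const (h : FullClosure f m θ) (hij : i ≠ j)
    (hθ : θ.letter i = j) (lo : ∀ q ≤ m, f q = i) :
    SpecialForm (seg f 0 m) (seg f 0 (2 * m + 2)) := by
  obtain ⟨k, hjk, hik⟩ := Letter.exists_third hij
  have up : ∀ q, m < q → q ≤ 2 * m + 1 → f q = j := fun q h1 h2 => by
    rw [h.mirror (2 * m + 1 - q) q (by omega), lo _ (by omega), hθ]
  have rep_lo : ∀ l ≤ m + 1, seg f 0 l = rep [i] l := fun l hl => by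
    have := seg_eq_rep (f := f) (x := [i]) (s := 0) (d := 1) (l := l) fun q hq => by
      rw [seg_one, lo _ (by omega)]
    rwa [Nat.mul_one] at this
  have rep_up : seg f (m + 1) (m + 1) = rep [j] (m + 1) := by
    have := seg_eq_rep (f := f) (x := [j]) (s := m + 1) (d := 1) (l := m + 1) fun q hq => by
      rw [seg_one, up _ (by omega) (by omega)]
    rwa [Nat.mul_one] at this
  refine ⟨i, j, k, hij, hjk, hik, m + 1, by omega, Or.inl ⟨?_, ?_, ?_⟩⟩
  · rw [show 2 * m + 2 = (m + 1) + (m + 1) by omega, seg_add, rep_lo _ le_rfl, Nat.zero_add,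
      rep_up]
  · exact rep_lo m (by omega)
  · rw [← rep_lo _ le_rfl]
    refine h.missed_iff_eq (by omega) (by omega) ⟨.R, fun a b hab => ?_⟩ ?_
    · rw [lo b (by omega), lo a (by omega)]
      rfl
    · rintro p hp h1 h2 ⟨t, ht⟩
      by_contra hne
      rcases hp with rfl | rfl | rfl | rfl
      · omega
      · have e1 := letter_eq_of_mirror (a := 0) (b := m + 1) ht (by omega) (lo _ (by omega))
          (up _ (by omega) (by omega))
        have e2 := letter_eq_of_mirror (a := 1) (b := m) ht (by omega) (lo _ (by omega))
          (lo _ (by omega))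
        grind
      · have e1 := letter_eq_of_mirror (a := m - 1) (b := m) ht (by omega) (lo _ (by omega))
          (lo _ (by omega))
        have e2 := letter_eq_of_mirror (a := m - 2) (b := m + 1) ht (by omega) (lo _ (by omega))
          (up _ (by omega) (by omega))
        grind
      · have e1 := letter_eq_of_mirror (a := m) (b := m) ht (by omega) (lo _ (by omega))
          (lo _ (by omega))
        have e2 := letter_eq_of_mirror (a := m - 1) (b := m + 1) ht (by omega) (lo _ (by omega))
          (up _ (by omega) (by omega))
        grind

theorem FullClosure.specialForm_of_alternating_odd (h : FullClosure f m θ) (hij : i ≠ j)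
    (hjk : j ≠ k) (hik : i ≠ k) (hm : m % 2 = 1) (hθi : θ.letter i = i) (hθj : θ.letter j = k)
    (lo0 : ∀ q ≤ m, q % 2 = 0 → f q = i) (lo1 : ∀ q ≤ m, q % 2 = 1 → f q = j) :
    SpecialForm (seg f 0 m) (seg f 0 (2 * m + 2)) := by
  have up0 : ∀ q, m < q → q ≤ 2 * m + 1 → q % 2 = 0 → f q = k := fun q h1 h2 h3 => by
    rw [h.mirror (2 * m + 1 - q) q (by omega), lo1 _ (by omega) (by omega), hθj]
  have up1 : ∀ q, m < q → q ≤ 2 * m + 1 → q % 2 = 1 → f q = i := fun q h1 h2 h3 => by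
    rw [h.mirror (2 * m + 1 - q) q (by omega), lo0 _ (by omega) (by omega), hθi]
  obtain ⟨l, rfl⟩ : ∃ l, m = 2 * l + 1 := ⟨m / 2, by omega⟩
  have rep_lo : ∀ n ≤ l + 1, seg f 0 (n * 2) = rep [i, j] n := fun n hn =>
    seg_eq_rep fun q hq => by
      rw [seg_two, lo0 _ (by omega) (by omega), lo1 _ (by omega) (by omega)]
  have rep_up : seg f ((l + 1) * 2) ((l + 1) * 2) = rep [k, i] (l + 1) :=
    seg_eq_rep fun q hq => by
      rw [seg_two, up0 _ (by omega) (by omega) (by omega), up1 _ (by omega) (by omega) (by omega)]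
  have hpal : PalPrefix f (2 * l + 1 + 1) := by
    obtain ⟨hi, hj, -⟩ := AM.letter_E hij hjk hik
    refine ⟨.E k, fun a b hab => ?_⟩
    rcases Nat.mod_two_eq_zero_or_one a with ha | ha
    · rw [lo0 a (by omega) ha, lo1 b (by omega) (by omega), hi]
    · rw [lo1 a (by omega) ha, lo0 b (by omega) (by omega), hj]
  refine ⟨i, j, k, hij, hjk, hik, l + 1, by omega, Or.inr (Or.inl ⟨?_, ?_, ?_, ?_⟩)⟩
  · rw [show 2 * (2 * l + 1) + 2 = (l + 1) * 2 + (l + 1) * 2 by omega, seg_add,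
      rep_lo _ le_rfl, Nat.zero_add, rep_up]
  · rw [show 2 * l + 1 = l * 2 + 1 by omega, seg_add, rep_lo _ (by omega), Nat.zero_add, seg_one,
      lo0 _ (by omega) (by omega), Nat.add_sub_cancel]
  · intro hl
    rw [← rep_lo _ le_rfl, show (l + 1) * 2 = 2 * l + 1 + 1 by omega]
    refine h.missed_iff_eq (by omega) (by omega) hpal ?_
    rintro p hp h1 h2 ⟨t, ht⟩
    by_contra hne
    rcases hp with rfl | rfl | rfl | rfl
    · omega
    · have e1 := letter_eq_of_mirror (a := 0) (b := 2 * l + 2) ht (by omega)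
        (lo0 _ (by omega) (by omega)) (up0 _ (by omega) (by omega) (by omega))
      have e2 := letter_eq_of_mirror (a := 2) (b := 2 * l) ht (by omega)
        (lo0 _ (by omega) (by omega)) (lo0 _ (by omega) (by omega))
      grind
    · have e1 := letter_eq_of_mirror (a := 2 * l) (b := 2 * l + 1) ht (by omega)
        (lo0 _ (by omega) (by omega)) (lo1 _ (by omega) (by omega))
      have e2 := letter_eq_of_mirror (a := 2 * l - 1) (b := 2 * l + 2) ht (by omega)
        (lo1 _ (by omega) (by omega)) (up0 _ (by omega) (by omega) (by omega))
      grind [AM.letter_letter]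
    · have e1 := letter_eq_of_mirror (a := 2 * l + 1) (b := 2 * l + 1) ht (by omega)
        (lo1 _ (by omega) (by omega)) (lo1 _ (by omega) (by omega))
      have e2 := letter_eq_of_mirror (a := 2 * l - 1) (b := 2 * l + 3) ht (by omega)
        (lo1 _ (by omega) (by omega)) (up1 _ (by omega) (by omega) (by omega))
      grind
  · intro hl v
    obtain rfl : l = 0 := by omega
    rw [missedBetween_seg_iff]
    have f0 : f 0 = i := lo0 _ (by omega) (by omega)
    have f1 : f 1 = j := lo1 _ (by omega) (by omega)
    have f2 : f 2 = k := up0 _ (by omega) (by omega) (by omega)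
    have s2 : seg f 0 2 = [i, j] := by rw [seg_two, f0, f1]
    have s3 : seg f 0 3 = [i, j, k] := by rw [seg_three, f0, f1, f2]
    rw [← s2, ← s3]
    constructor
    · rintro ⟨p, h1, h2, -, rfl⟩
      obtain rfl | rfl : p = 2 ∨ p = 3 := by omega
      · exact Or.inl rfl
      · exact Or.inr rfl
    · rintro (rfl | rfl)
      · exact ⟨2, by omega, by omega, hpal, rfl⟩
      · refine ⟨3, by omega, by omega, ⟨.E j, fun a b hab => ?_⟩, rfl⟩
        obtain ⟨hi, hk, hj⟩ := AM.letter_E hik hjk.symm hij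
        obtain ⟨rfl, rfl⟩ | ⟨rfl, rfl⟩ | ⟨rfl, rfl⟩ :
          (a = 0 ∧ b = 2) ∨ (a = 1 ∧ b = 1) ∨ (a = 2 ∧ b = 0) := by omega
        · rw [f0, f2, hi]
        · rw [f1, hj]
        · rw [f0, f2, hk]

theorem FullClosure.specialForm_of_alternating_even (h : FullClosure f m θ) (hij : i ≠ j)
    (hjk : j ≠ k) (hik : i ≠ k) (hm : m % 2 = 0) (hm' : 0 < m) (hθi : θ.letter i = k)
    (hθj : θ.letter j = j)
    (lo0 : ∀ q ≤ m, q % 2 = 0 → f q = i) (lo1 : ∀ q ≤ m, q % 2 = 1 → f q = j) :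
    SpecialForm (seg f 0 m) (seg f 0 (2 * m + 2)) := by
  have up0 : ∀ q, m < q → q ≤ 2 * m + 1 → q % 2 = 0 → f q = j := fun q h1 h2 h3 => by
    rw [h.mirror (2 * m + 1 - q) q (by omega), lo1 _ (by omega) (by omega), hθj]
  have up1 : ∀ q, m < q → q ≤ 2 * m + 1 → q % 2 = 1 → f q = k := fun q h1 h2 h3 => by
    rw [h.mirror (2 * m + 1 - q) q (by omega), lo0 _ (by omega) (by omega), hθi]
  obtain ⟨l, rfl⟩ : ∃ l, m = l * 2 := ⟨m / 2, by omega⟩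
  have rep_lo : seg f 0 (l * 2) = rep [i, j] l := seg_eq_rep fun q hq => by
    rw [seg_two, lo0 _ (by omega) (by omega), lo1 _ (by omega) (by omega)]
  have rep_up : seg f (l * 2 + 2) (l * 2) = rep [j, k] l := seg_eq_rep fun q hq => by
    rw [seg_two, up0 _ (by omega) (by omega) (by omega), up1 _ (by omega) (by omega) (by omega)]
  refine ⟨i, j, k, hij, hjk, hik, l, by omega, Or.inr (Or.inr (Or.inl ⟨?_, rep_lo, ?_⟩))⟩
  · rw [show 2 * (l * 2) + 2 = l * 2 + 2 + l * 2 by omega, seg_add, seg_add, rep_lo, Nat.zero_add,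
      Nat.zero_add, rep_up, seg_two, lo0 _ (by omega) (by omega),
      up1 _ (by omega) (by omega) (by omega)]
  · have hZ : rep [i, j] l ++ [i] = seg f 0 (l * 2 + 1) := by
      rw [seg_add, rep_lo, Nat.zero_add, seg_one, lo0 _ (by omega) (by omega)]
    rw [hZ]
    refine h.missed_iff_eq (by omega) (by omega) ⟨.R, fun a b hab => ?_⟩ ?_
    · rcases Nat.mod_two_eq_zero_or_one a with ha | ha
      · rw [lo0 a (by omega) ha, lo0 b (by omega) (by omega)]
        rfl
      · rw [lo1 a (by omega) ha, lo1 b (by omega) (by omega)]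
        rfl
    rintro p hp h1 h2 ⟨t, ht⟩
    by_contra hne
    rcases hp with rfl | rfl | rfl | rfl
    · omega
    · have e1 := letter_eq_of_mirror (a := 0) (b := l * 2 + 1) ht (by omega)
        (lo0 _ (by omega) (by omega)) (up1 _ (by omega) (by omega) (by omega))
      have e2 := letter_eq_of_mirror (a := 1) (b := l * 2) ht (by omega)
        (lo1 _ (by omega) (by omega)) (lo0 _ (by omega) (by omega))
      grind [AM.letter_letter]
    · have e1 := letter_eq_of_mirror (a := l * 2 - 1) (b := l * 2) ht (by omega)
        (lo1 _ (by omega) (by omega)) (lo0 _ (by omega) (by omega))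
      have e2 := letter_eq_of_mirror (a := l * 2 - 2) (b := l * 2 + 1) ht (by omega)
        (lo0 _ (by omega) (by omega)) (up1 _ (by omega) (by omega) (by omega))
      grind [AM.letter_letter]
    · have e1 := letter_eq_of_mirror (a := l * 2) (b := l * 2) ht (by omega)
        (lo0 _ (by omega) (by omega)) (lo0 _ (by omega) (by omega))
      have e2 := letter_eq_of_mirror (a := l * 2 - 2) (b := l * 2 + 2) ht (by omega)
        (lo0 _ (by omega) (by omega)) (up0 _ (by omega) (by omega) (by omega))
      grind

theorem FullClosure.specialForm_of_three_mod_four (h : FullClosure f m θ) (hij : i ≠ j)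
    (hjk : j ≠ k) (hik : i ≠ k) (hm : m % 4 = 3) (hθi : θ.letter i = j)
    (hθk : θ.letter k = k) (lo0 : ∀ q ≤ m, q % 4 = 0 → f q = i)
    (lo1 : ∀ q ≤ m, q % 2 = 1 → f q = j) (lo2 : ∀ q ≤ m, q % 4 = 2 → f q = k) :
    SpecialForm (seg f 0 m) (seg f 0 (2 * m + 2)) := by
  have hθj : θ.letter j = i := by rw [← hθi, θ.letter_letter]
  have up0 : ∀ q, m < q → q ≤ 2 * m + 1 → q % 2 = 0 → f q = i := fun q h1 h2 h3 => by
    rw [h.mirror (2 * m + 1 - q) q (by omega), lo1 _ (by omega) (by omega), hθj]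
  have up1 : ∀ q, m < q → q ≤ 2 * m + 1 → q % 4 = 1 → f q = k := fun q h1 h2 h3 => by
    rw [h.mirror (2 * m + 1 - q) q (by omega), lo2 _ (by omega) (by omega), hθk]
  have up3 : ∀ q, m < q → q ≤ 2 * m + 1 → q % 4 = 3 → f q = j := fun q h1 h2 h3 => by
    rw [h.mirror (2 * m + 1 - q) q (by omega), lo0 _ (by omega) (by omega), hθi]
  obtain ⟨l, rfl⟩ : ∃ l, m = l * 4 + 3 := ⟨m / 4, by omega⟩
  have rep_lo : ∀ n ≤ l + 1, seg f 0 (n * 4) = rep [i, j, k, j] n := fun n hn =>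
    seg_eq_rep fun q hq => by
      rw [seg_four, lo0 _ (by omega) (by omega), lo1 _ (by omega) (by omega),
        lo2 _ (by omega) (by omega), lo1 _ (by omega) (by omega)]
  have rep_up : seg f ((l + 1) * 4) ((l + 1) * 4) = rep [i, k, i, j] (l + 1) :=
    seg_eq_rep fun q hq => by
      rw [seg_four, up0 _ (by omega) (by omega) (by omega),
        up1 _ (by omega) (by omega) (by omega), up0 _ (by omega) (by omega) (by omega),
        up3 _ (by omega) (by omega) (by omega)]
  refine ⟨i, j, k, hij, hjk, hik, l + 1, by omega,
    Or.inr (Or.inr (Or.inr (Or.inr (Or.inr (Or.inr (Or.inl ⟨?_, ?_, ?_⟩))))))⟩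
  · rw [show 2 * (l * 4 + 3) + 2 = (l + 1) * 4 + (l + 1) * 4 by omega, seg_add,
      rep_lo _ le_rfl, Nat.zero_add, rep_up]
  · rw [seg_add, rep_lo _ (by omega), Nat.zero_add, seg_three, lo0 _ (by omega) (by omega),
      lo1 _ (by omega) (by omega), lo2 _ (by omega) (by omega), Nat.add_sub_cancel]
  · have hZ : rep [i, j, k, j] (l + 1) ++ [i] = seg f 0 (l * 4 + 3 + 2) := by
      rw [show l * 4 + 3 + 2 = (l + 1) * 4 + 1 by omega, seg_add, rep_lo _ le_rfl, Nat.zero_add,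
        seg_one, up0 _ (by omega) (by omega) (by omega)]
    rw [hZ]
    refine h.missed_iff_eq (by omega) (by omega) ⟨.R, fun a b hab => ?_⟩ ?_
    · have lo0' : ∀ q ≤ l * 4 + 4, q % 4 = 0 → f q = i := fun q h1 h2 => by
        rcases Nat.lt_or_ge (l * 4 + 3) q with h3 | h3
        · exact up0 q h3 (by omega) (by omega)
        · exact lo0 q h3 h2
      change f b = f a
      obtain ha | ha | ha : a % 4 = 0 ∨ a % 2 = 1 ∨ a % 4 = 2 := by omega
      · rw [lo0' a (by omega) ha, lo0' b (by omega) (by omega)]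
      · rw [lo1 a (by omega) ha, lo1 b (by omega) (by omega)]
      · rw [lo2 a (by omega) ha, lo2 b (by omega) (by omega)]
    rintro p hp h1 h2 ⟨t, ht⟩
    by_contra hne
    rcases hp with rfl | rfl | rfl | rfl
    · have e1 := letter_eq_of_mirror (a := 0) (b := l * 4 + 3) ht (by omega)
        (lo0 _ (by omega) (by omega)) (lo1 _ (by omega) (by omega))
      have e2 := letter_eq_of_mirror (a := 1) (b := l * 4 + 2) ht (by omega)
        (lo1 _ (by omega) (by omega)) (lo2 _ (by omega) (by omega))
      grind [AM.letter_letter]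
    · omega
    · have e1 := letter_eq_of_mirror (a := l * 4 + 2) (b := l * 4 + 3) ht (by omega)
        (lo2 _ (by omega) (by omega)) (lo1 _ (by omega) (by omega))
      have e2 := letter_eq_of_mirror (a := l * 4 + 1) (b := l * 4 + 4) ht (by omega)
        (lo1 _ (by omega) (by omega)) (up0 _ (by omega) (by omega) (by omega))
      grind [AM.letter_letter]
    · have e1 := letter_eq_of_mirror (a := l * 4 + 3) (b := l * 4 + 3) ht (by omega)
        (lo1 _ (by omega) (by omega)) (lo1 _ (by omega) (by omega))
      have e2 := letter_eq_of_mirror (a := l * 4 + 1) (b := l * 4 + 5) ht (by omega)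
        (lo1 _ (by omega) (by omega)) (up1 _ (by omega) (by omega) (by omega))
      grind

theorem FullClosure.specialForm_of_one_mod_four (h : FullClosure f m θ) (hij : i ≠ j)
    (hjk : j ≠ k) (hik : i ≠ k) (hm : m % 4 = 1) (hm' : 1 < m) (hθi : θ.letter i = i)
    (hθj : θ.letter j = k) (lo0 : ∀ q ≤ m, q % 4 = 0 → f q = i)
    (lo1 : ∀ q ≤ m, q % 2 = 1 → f q = j) (lo2 : ∀ q ≤ m, q % 4 = 2 → f q = k) :
    SpecialForm (seg f 0 m) (seg f 0 (2 * m + 2)) := by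
  have hθk : θ.letter k = j := by rw [← hθj, θ.letter_letter]
  have up0 : ∀ q, m < q → q ≤ 2 * m + 1 → q % 2 = 0 → f q = k := fun q h1 h2 h3 => by
    rw [h.mirror (2 * m + 1 - q) q (by omega), lo1 _ (by omega) (by omega), hθj]
  have up1 : ∀ q, m < q → q ≤ 2 * m + 1 → q % 4 = 1 → f q = j := fun q h1 h2 h3 => by
    rw [h.mirror (2 * m + 1 - q) q (by omega), lo2 _ (by omega) (by omega), hθk]
  have up3 : ∀ q, m < q → q ≤ 2 * m + 1 → q % 4 = 3 → f q = i := fun q h1 h2 h3 => by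
    rw [h.mirror (2 * m + 1 - q) q (by omega), lo0 _ (by omega) (by omega), hθi]
  obtain ⟨l, rfl⟩ : ∃ l, m = l * 4 + 1 := ⟨m / 4, by omega⟩
  have rep_lo : seg f 0 (l * 4) = rep [i, j, k, j] l := seg_eq_rep fun q hq => by
    rw [seg_four, lo0 _ (by omega) (by omega), lo1 _ (by omega) (by omega),
      lo2 _ (by omega) (by omega), lo1 _ (by omega) (by omega)]
  have rep_up : seg f (l * 4 + 4) (l * 4) = rep [k, j, k, i] l := seg_eq_rep fun q hq => by
    rw [seg_four, up0 _ (by omega) (by omega) (by omega),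
      up1 _ (by omega) (by omega) (by omega), up0 _ (by omega) (by omega) (by omega),
      up3 _ (by omega) (by omega) (by omega)]
  refine ⟨i, j, k, hij, hjk, hik, l, by omega,
    Or.inr (Or.inr (Or.inr (Or.inr (Or.inr (Or.inr (Or.inr ⟨?_, ?_, ?_⟩))))))⟩
  · rw [show 2 * (l * 4 + 1) + 2 = l * 4 + 4 + l * 4 by omega, seg_add, seg_add,
      rep_lo, Nat.zero_add, Nat.zero_add, rep_up, seg_four, lo0 _ (by omega) (by omega),
      lo1 _ (by omega) (by omega), up0 _ (by omega) (by omega) (by omega),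
      up3 _ (by omega) (by omega) (by omega)]
  · rw [seg_add, rep_lo, Nat.zero_add, seg_one, lo0 _ (by omega) (by omega)]
  · have hZ : rep [i, j, k, j] l ++ [i, j, k] = seg f 0 (l * 4 + 1 + 2) := by
      rw [show l * 4 + 1 + 2 = l * 4 + 3 by omega, seg_add, rep_lo, Nat.zero_add,
        seg_three, lo0 _ (by omega) (by omega), lo1 _ (by omega) (by omega),
        up0 _ (by omega) (by omega) (by omega)]
    rw [hZ]
    refine h.missed_iff_eq (by omega) (by omega) ⟨.E j, fun a b hab => ?_⟩ ?_
    · have lo2' : ∀ q ≤ l * 4 + 2, q % 4 = 2 → f q = k := fun q h1 h2 => by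
        rcases Nat.lt_or_ge (l * 4 + 1) q with h3 | h3
        · exact up0 q h3 (by omega) (by omega)
        · exact lo2 q h3 h2
      obtain ⟨hi, hk, hj⟩ := AM.letter_E hik hjk.symm hij
      obtain ha | ha | ha : a % 4 = 0 ∨ a % 2 = 1 ∨ a % 4 = 2 := by omega
      · rw [lo0 a (by omega) ha, lo2' b (by omega) (by omega), hi]
      · rw [lo1 a (by omega) ha, lo1 b (by omega) (by omega), hj]
      · rw [lo2' a (by omega) ha, lo0 b (by omega) (by omega), hk]
    rintro p hp h1 h2 ⟨t, ht⟩
    by_contra hne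
    rcases hp with rfl | rfl | rfl | rfl
    · have e1 := letter_eq_of_mirror (a := 0) (b := l * 4 + 1) ht (by omega)
        (lo0 _ (by omega) (by omega)) (lo1 _ (by omega) (by omega))
      have e2 := letter_eq_of_mirror (a := 2) (b := l * 4 - 1) ht (by omega)
        (lo2 _ (by omega) (by omega)) (lo1 _ (by omega) (by omega))
      grind [AM.letter_letter]
    · omega
    · have e1 := letter_eq_of_mirror (a := l * 4) (b := l * 4 + 1) ht (by omega)
        (lo0 _ (by omega) (by omega)) (lo1 _ (by omega) (by omega))
      have e2 := letter_eq_of_mirror (a := l * 4 - 1) (b := l * 4 + 2) ht (by omega)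
        (lo1 _ (by omega) (by omega)) (up0 _ (by omega) (by omega) (by omega))
      grind [AM.letter_letter]
    · have e1 := letter_eq_of_mirror (a := l * 4 + 1) (b := l * 4 + 1) ht (by omega)
        (lo1 _ (by omega) (by omega)) (lo1 _ (by omega) (by omega))
      have e2 := letter_eq_of_mirror (a := l * 4 - 1) (b := l * 4 + 3) ht (by omega)
        (lo1 _ (by omega) (by omega)) (up3 _ (by omega) (by omega) (by omega))
      grind

end Rows

section ShortForms

variable {f : ℕ → Letter} {θ : AM} {i j k : Letter}

theorem FullClosure.specialForm_ijjiij (h : FullClosure f 2 θ) (hij : i ≠ j)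
    (hθi : θ.letter i = j) (f0 : f 0 = i) (f1 : f 1 = j) (f2 : f 2 = j) :
    SpecialForm (seg f 0 2) (seg f 0 (2 * 2 + 2)) := by
  obtain ⟨k, hjk, hik⟩ := Letter.exists_third hij
  have hθj : θ.letter j = i := by rw [← hθi, θ.letter_letter]
  have f3 : f 3 = i := by rw [h.mirror 2 3 rfl, f2, hθj]
  have f4 : f 4 = i := by rw [h.mirror 1 4 rfl, f1, hθj]
  have f5 : f 5 = j := by rw [h.mirror 0 5 rfl, f0, hθi]
  have s4 : seg f 0 4 = [i, j, j, i] := by simp [seg, List.range', *]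
  refine ⟨i, j, k, hij, hjk, hik, 1, le_rfl,
    Or.inr (Or.inr (Or.inr (Or.inr (Or.inr (Or.inl ⟨?_, ?_, ?_⟩)))))⟩
  · simp [seg, List.range', *]
  · simp [seg, List.range', *]
  · rw [← s4]
    refine h.missed_iff_eq (by omega) (by omega) ⟨.R, fun a b hab => ?_⟩ ?_
    · obtain rfl : b = 3 - a := by omega
      have ha : a ≤ 3 := by omega
      interval_cases a <;> simp [AM.letter, *]
    · rintro p hp h1 h2 ⟨t, ht⟩
      obtain rfl | rfl | rfl : p = 3 ∨ p = 4 ∨ p = 5 := by omega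
      · have e1 := letter_eq_of_mirror (a := 0) (b := 2) ht rfl f0 f2
        have e2 := letter_eq_of_mirror (a := 1) (b := 1) ht rfl f1 f1
        grind [AM.letter_letter]
      · rfl
      · have e1 := letter_eq_of_mirror (a := 0) (b := 4) ht rfl f0 f4
        have e2 := letter_eq_of_mirror (a := 1) (b := 3) ht rfl f1 f3
        grind [AM.letter_letter]

theorem FullClosure.specialForm_ijjkki (h : FullClosure f 2 θ) (hij : i ≠ j) (hjk : j ≠ k)
    (hik : i ≠ k) (hθi : θ.letter i = i) (hθj : θ.letter j = k) (f0 : f 0 = i) (f1 : f 1 = j)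
    (f2 : f 2 = j) : SpecialForm (seg f 0 2) (seg f 0 (2 * 2 + 2)) := by
  have f3 : f 3 = k := by rw [h.mirror 2 3 rfl, f2, hθj]
  have f4 : f 4 = k := by rw [h.mirror 1 4 rfl, f1, hθj]
  have f5 : f 5 = i := by rw [h.mirror 0 5 rfl, f0, hθi]
  have s4 : seg f 0 4 = [i, j, j, k] := by simp [seg, List.range', *]
  obtain ⟨hi, hk, hj⟩ := AM.letter_E hik hjk.symm hij
  refine ⟨i, j, k, hij, hjk, hik, 1, le_rfl,
    Or.inr (Or.inr (Or.inr (Or.inr (Or.inl ⟨?_, ?_, ?_⟩))))⟩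
  · simp [seg, List.range', *]
  · simp [seg, List.range', *]
  · rw [← s4]
    refine h.missed_iff_eq (by omega) (by omega) ⟨.E j, fun a b hab => ?_⟩ ?_
    · obtain rfl : b = 3 - a := by omega
      have ha : a ≤ 3 := by omega
      interval_cases a <;> simp [*]
    · rintro p hp h1 h2 ⟨t, ht⟩
      obtain rfl | rfl | rfl : p = 3 ∨ p = 4 ∨ p = 5 := by omega
      · have e1 := letter_eq_of_mirror (a := 0) (b := 2) ht rfl f0 f2
        have e2 := letter_eq_of_mirror (a := 1) (b := 1) ht rfl f1 f1
        grind [AM.letter_letter]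
      · rfl
      · have e1 := letter_eq_of_mirror (a := 0) (b := 4) ht rfl f0 f4
        have e2 := letter_eq_of_mirror (a := 1) (b := 3) ht rfl f1 f3
        grind [AM.letter_letter]

theorem FullClosure.specialForm_ijjkkiijjk (h : FullClosure f 4 θ) (hij : i ≠ j) (hjk : j ≠ k)
    (hik : i ≠ k) (hθj : θ.letter j = j) (hθk : θ.letter k = i) (f0 : f 0 = i) (f1 : f 1 = j)
    (f2 : f 2 = j) (f3 : f 3 = k) (f4 : f 4 = k) :
    SpecialForm (seg f 0 4) (seg f 0 (2 * 4 + 2)) := by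
  have hθi : θ.letter i = k := by rw [← hθk, θ.letter_letter]
  have f5 : f 5 = i := by rw [h.mirror 4 5 rfl, f4, hθk]
  have f6 : f 6 = i := by rw [h.mirror 3 6 rfl, f3, hθk]
  have f7 : f 7 = j := by rw [h.mirror 2 7 rfl, f2, hθj]
  have f8 : f 8 = j := by rw [h.mirror 1 8 rfl, f1, hθj]
  have f9 : f 9 = k := by rw [h.mirror 0 9 rfl, f0, hθi]
  have s6 : seg f 0 6 = [i, j, j, k, k, i] := by simp [seg, List.range', *]
  have s8 : seg f 0 8 = [i, j, j, k, k, i, i, j] := by simp [seg, List.range', *]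
  refine ⟨i, j, k, hij, hjk, hik, 1, le_rfl, Or.inr (Or.inr (Or.inr (Or.inl ⟨?_, ?_, ?_⟩)))⟩
  · simp [seg, List.range', *]
  · simp [seg, List.range', *]
  · intro v
    rw [← s6, ← s8, missedBetween_seg_iff]
    constructor
    · rintro ⟨p, h1, h2, hp, rfl⟩
      have hcases := h.length_cases h1 h2 hp
      obtain ⟨t, ht⟩ := hp
      obtain rfl | rfl | rfl | rfl : p = 5 ∨ p = 6 ∨ p = 8 ∨ p = 9 := by omega
      · have e1 := letter_eq_of_mirror (a := 0) (b := 4) ht rfl f0 f4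
        have e2 := letter_eq_of_mirror (a := 1) (b := 3) ht rfl f1 f3
        grind [AM.letter_letter]
      · exact Or.inl rfl
      · exact Or.inr rfl
      · have e1 := letter_eq_of_mirror (a := 0) (b := 8) ht rfl f0 f8
        have e2 := letter_eq_of_mirror (a := 1) (b := 7) ht rfl f1 f7
        grind [AM.letter_letter]
    · rintro (rfl | rfl)
      · obtain ⟨hj, hk, hi⟩ := AM.letter_E hjk hik.symm hij.symm
        refine ⟨6, by omega, by omega, ⟨.E i, fun a b hab => ?_⟩, rfl⟩
        obtain rfl : b = 5 - a := by omega
        have ha : a ≤ 5 := by omega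
        interval_cases a <;> simp [*]
      · obtain ⟨hi, hj, hk⟩ := AM.letter_E hij hjk hik
        refine ⟨8, by omega, by omega, ⟨.E k, fun a b hab => ?_⟩, rfl⟩
        obtain rfl : b = 7 - a := by omega
        have ha : a ≤ 7 := by omega
        interval_cases a <;> simp [*]

end ShortForms

section Shift

variable {f : ℕ → Letter} {m : ℕ} {θ : AM}

/-- The suffix starting at position `s` of the word of length `m + 1` to be closed is not
a `θ`-palindrome; by symmetry this is witnessed in its left half. -/
theorem FullClosure.exists_ne (h : FullClosure f m θ) {s : ℕ} (hs : s ≤ m) :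
    ∃ d : ℕ, 2 * d ≤ m - s ∧ f (s + d) ≠ θ.letter (f (m - d)) := by
  obtain ⟨a, b, hab, ha, hb, hne⟩ := h.minimal s hs
  rcases Nat.le_total a b with hle | hle
  · refine ⟨a - s, by omega, fun heq => hne ?_⟩
    rw [show s + (a - s) = a by omega, show m - (a - s) = b by omega] at heq
    rw [heq, θ.letter_letter]
  · refine ⟨b - s, by omega, fun heq => hne ?_⟩
    rwa [show s + (b - s) = b by omega, show m - (b - s) = a by omega] at heq

theorem FullClosure.letter_ne (h : FullClosure f m θ) : θ.letter (f m) ≠ f m := by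
  obtain ⟨d, hd, hne⟩ := h.exists_ne (le_refl m)
  obtain rfl : d = 0 := by omega
  simpa using hne.symm

theorem FullClosure.pred_ne (h : FullClosure f m θ) (hm : 1 ≤ m) :
    f (m - 1) ≠ θ.letter (f m) := by
  obtain ⟨d, hd, hne⟩ := h.exists_ne (Nat.sub_le m 1)
  obtain rfl : d = 0 := by omega
  simpa using hne

theorem FullClosure.pred_pred_ne (h : FullClosure f m θ) (hm : 2 ≤ m)
    (hfix : θ.letter (f (m - 1)) = f (m - 1)) : f (m - 2) ≠ θ.letter (f m) := by
  obtain ⟨d, hd, hne⟩ := h.exists_ne (Nat.sub_le m 2)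
  obtain rfl | rfl : d = 0 ∨ d = 1 := by omega
  · simpa using hne
  · rw [show m - 2 + 1 = m - 1 by omega] at hne
    exact absurd hfix.symm hne

theorem FullClosure.specialForm_of_shift_one
    (h : FullClosure f m θ) {r : Letter → Letter} (hr : Function.Injective r)
    (hs : ∀ q < m, f q = r (f (q + 1))) : SpecialForm (seg f 0 m) (seg f 0 (2 * m + 2)) := by
  have h0 := h.letter_ne
  have hs' : ∀ q < m, f (m - (q + 1)) = r (f (m - q)) := fun q hq => by
    rw [hs _ (by omega), show m - (q + 1) + 1 = m - q by omega]
  by_cases hm : m = 0 ∨ f (m - 1) = f m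
  · refine h.specialForm_of_const (i := f m) h0.symm rfl ?_
    suffices hd : ∀ q ≤ m, f (m - q) = f m by
      intro q hq
      have := hd (m - q) (by omega)
      rwa [Nat.sub_sub_self hq] at this
    intro q
    induction q with
    | zero => simp
    | succ q ih =>
      intro hq
      have e : f (m - 1) = r (f m) := hs' 0 (by omega)
      rw [hs' q (by omega), ih (by omega), ← e]
      exact hm.resolve_left (by omega)
  · push Not at hm
    obtain ⟨hm, hne⟩ := hm
    have h1 := h.pred_ne (by omega)
    have hfix := θ.letter_third h0 hne h1
    have e1 : f (m - 1) = r (f m) := hs' 0 (by omega)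
    have e2 : 2 ≤ m → r (f (m - 1)) = f m := fun hm2 => by
      have e3 : f (m - 2) = r (f (m - 1)) := hs' 1 (by omega)
      have hne2 := h.pred_pred_ne hm2 hfix
      have hne3 : r (f (m - 1)) ≠ r (f m) := fun h => hne (hr h)
      rcases Letter.eq_or_eq_or_eq hne h0.symm h1 (f (m - 2)) with h2 | h2 | h2
      · rw [← e1, ← e3] at hne3
        exact absurd h2 hne3
      · rw [← e3, h2]
      · exact absurd h2 hne2
    have hd : ∀ q ≤ m, f (m - q) = if q % 2 = 0 then f m else f (m - 1) := by
      intro q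
      induction q with
      | zero => simp
      | succ q ih =>
        intro hq
        rw [hs' q (by omega), ih (by omega)]
        rcases Nat.mod_two_eq_zero_or_one q with h2 | h2
        · rw [if_pos h2, if_neg (by omega), e1]
        · rw [if_neg (by omega), if_pos (by omega), e2 (by omega)]
    have hd' : ∀ q ≤ m, f q = if (m - q) % 2 = 0 then f m else f (m - 1) := fun q hq => by
      rw [← hd _ (by omega), Nat.sub_sub_self hq]
    rcases Nat.mod_two_eq_zero_or_one m with h2 | h2
    · exact h.specialForm_of_alternating_even hne.symm h1 h0.symm h2 (by omega) rfl hfix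
        (fun q hq hq2 => by rw [hd' q hq, if_pos (by omega)])
        (fun q hq hq2 => by rw [hd' q hq, if_neg (by omega)])
    · exact h.specialForm_of_alternating_odd hne h0.symm h1 h2 hfix rfl
        (fun q hq hq2 => by rw [hd' q hq, if_neg (by omega)])
        (fun q hq hq2 => by rw [hd' q hq, if_pos (by omega)])

theorem FullClosure.specialForm_of_shift_two_of_eq
    (h : FullClosure f m θ) (hm : 2 ≤ m) {r : Letter → Letter} (hr : Function.Injective r)
    (hs : ∀ q < m, f q = r (f (q + 2))) (heq : f (m - 1) = f m) :
    SpecialForm (seg f 0 m) (seg f 0 (2 * m + 2)) := by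
  have h0 := h.letter_ne
  obtain ⟨c, hc0, hc1⟩ := Letter.exists_third h0
  have hfix := θ.letter_third h0 hc0.symm hc1.symm
  have hs' : ∀ q, q + 2 ≤ m → f (m - (q + 2)) = r (f (m - q)) := fun q hq => by
    rw [hs _ (by omega), show m - (q + 2) + 2 = m - q by omega]
  have e1 : r (θ.letter (f m)) = f m := by
    have := hs (m - 1) (by omega)
    rw [show m - 1 + 2 = m + 1 by omega, h.mirror m (m + 1) (by omega), heq] at this
    exact this.symm
  have e2 : f (m - 2) = r (f m) := hs' 0 hm
  have hr1 : r (f m) ≠ f m := fun hcon => h0 (hr (e1.trans hcon.symm))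
  rcases Letter.eq_or_eq_or_eq h0 hc0 hc1 (r (f m)) with hr2 | hr2 | hr2
  · rcases Nat.lt_or_ge 2 m with hm3 | hm2
    · obtain ⟨d, hd, hne⟩ := h.exists_ne (Nat.sub_le m 3)
      obtain rfl | rfl : d = 0 ∨ d = 1 := by omega
      · have e3 : f (m - 3) = r (f (m - 1)) := hs' 1 (by omega)
        refine absurd ?_ hne
        rw [Nat.add_zero, Nat.sub_zero, e3, heq, hr2]
      · refine absurd ?_ hne
        rw [show m - 3 + 1 = m - 2 by omega, e2, heq, hr2]
    · obtain rfl : m = 2 := by omega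
      exact h.specialForm_ijjiij h0 (θ.letter_letter _) (e2.trans hr2) heq rfl
  · exact absurd hr2 hr1
  · have hrc : r c = θ.letter (f m) := by
      rcases Letter.eq_or_eq_or_eq h0 hc0 hc1 (r c) with h3 | h3 | h3
      · exact h3
      · exact absurd (hr (h3.trans e1.symm)).symm hc1
      · exact absurd (hr (h3.trans hr2.symm)).symm hc0
    rw [hr2] at e2
    have e3 : 3 ≤ m → f (m - 3) = c := fun h3 => by
      have : f (m - 3) = r (f (m - 1)) := hs' 1 h3
      rw [this, heq, hr2]
    have e4 : 4 ≤ m → f (m - 4) = θ.letter (f m) := fun h4 => by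
      have : f (m - 4) = r (f (m - 2)) := hs' 2 h4
      rw [this, e2, hrc]
    obtain rfl | rfl | rfl | h5 : m = 2 ∨ m = 3 ∨ m = 4 ∨ 5 ≤ m := by omega
    · exact h.specialForm_ijjkki hc0.symm h0.symm hc1.symm hfix rfl e2 heq rfl
    · obtain ⟨t, ht⟩ := h.palPrefix
      have t1 := letter_eq_of_mirror (a := 0) (b := 2) ht rfl (e3 le_rfl) heq
      have t2 := letter_eq_of_mirror (a := 1) (b := 1) ht rfl e2 e2
      exact absurd (t1.symm.trans t2) hc0
    · exact h.specialForm_ijjkkiijjk hc1 hc0.symm h0 hfix rfl (e4 le_rfl) (e3 (by omega)) e2 heq rfl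
    · have e5 : f (m - 5) = r (f (m - 3)) := hs' 3 h5
      rw [e3 (by omega), hrc] at e5
      obtain ⟨d, hd, hne⟩ := h.exists_ne (Nat.sub_le m 5)
      obtain rfl | rfl | rfl : d = 0 ∨ d = 1 ∨ d = 2 := by omega
      · exact absurd e5 hne
      · refine absurd ?_ hne
        rw [show m - 5 + 1 = m - 4 by omega, e4 (by omega), heq]
      · refine absurd ?_ hne
        rw [show m - 5 + 2 = m - 3 by omega, e3 (by omega), e2, hfix]

theorem FullClosure.specialForm_of_shift_two_of_ne
    (h : FullClosure f m θ) (hm : 2 ≤ m) {r : Letter → Letter} (hr : Function.Injective r)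
    (hs : ∀ q < m, f q = r (f (q + 2))) (hne : f (m - 1) ≠ f m) :
    SpecialForm (seg f 0 m) (seg f 0 (2 * m + 2)) := by
  have h0 := h.letter_ne
  have h1 := h.pred_ne (by omega)
  have hfix := θ.letter_third h0 hne h1
  have h2 := h.pred_pred_ne hm hfix
  have hs' : ∀ q < m, f (m + 1 - (q + 2)) = r (f (m + 1 - q)) := fun q hq => by
    rw [hs _ (by omega), show m + 1 - (q + 2) + 2 = m + 1 - q by omega]
  have f0 : f (m + 1) = θ.letter (f m) := h.mirror m (m + 1) (by omega)
  have e1 : f (m - 1) = r (θ.letter (f m)) := by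
    rw [← f0]
    exact hs' 0 (by omega)
  have e2 : f (m - 2) = r (f m) := hs' 1 (by omega)
  have r1 : r (f m) = f m := by
    rcases Letter.eq_or_eq_or_eq hne h0.symm h1 (r (f m)) with h3 | h3 | h3
    · exact absurd (hr (h3.trans e1)).symm h0
    · exact h3
    · exact absurd (e2.trans h3) h2
  have r2 : r (f (m - 1)) = θ.letter (f m) := by
    rcases Letter.eq_or_eq_or_eq hne h0.symm h1 (r (f (m - 1))) with h3 | h3 | h3
    · exact absurd (hr (h3.trans e1)) h1
    · exact absurd (hr (h3.trans r1.symm)) hne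
    · exact h3
  have hd : ∀ q ≤ m + 1, f (m + 1 - q) =
      if q % 2 = 1 then f m else if q % 4 = 0 then θ.letter (f m) else f (m - 1) := by
    intro q
    induction q using Nat.twoStepInduction with
    | zero => simpa using f0
    | one => simp
    | more q ih _ =>
      intro hq
      rw [hs' q (by omega), ih (by omega)]
      obtain h3 | h3 | h3 : q % 2 = 1 ∨ q % 4 = 0 ∨ q % 4 = 2 := by omega
      · rw [if_pos h3, if_pos (by omega), r1]
      · rw [if_neg (by omega), if_pos h3, if_neg (by omega), if_neg (by omega), e1]
      · rw [if_neg (by omega), if_neg (by omega), if_neg (by omega), if_pos (by omega), r2]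
  have hodd : ∀ q ≤ m + 1, (m + 1 - q) % 2 = 1 → f q = f m := fun q hq h3 => by
    have := hd (m + 1 - q) (by omega)
    rwa [Nat.sub_sub_self hq, if_pos h3] at this
  have hzero : ∀ q ≤ m + 1, (m + 1 - q) % 4 = 0 → f q = θ.letter (f m) := fun q hq h3 => by
    have := hd (m + 1 - q) (by omega)
    rwa [Nat.sub_sub_self hq, if_neg (by omega), if_pos h3] at this
  have htwo : ∀ q ≤ m + 1, (m + 1 - q) % 4 = 2 → f q = f (m - 1) := fun q hq h3 => by
    have := hd (m + 1 - q) (by omega)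
    rwa [Nat.sub_sub_self hq, if_neg (by omega), if_neg (by omega)] at this
  obtain hm2 | hm2 | hm2 : m % 2 = 0 ∨ m % 4 = 3 ∨ m % 4 = 1 := by omega
  · obtain rfl | hm4 : m = 2 ∨ 4 ≤ m := by omega
    · exact h.specialForm_of_alternating_even hne.symm h1 h0.symm rfl (by omega) rfl hfix
        (fun q hq hq2 => hodd q (by omega) (by omega))
        (fun q hq hq2 => htwo q (by omega) (by omega))
    · obtain ⟨t, ht⟩ := h.palPrefix
      have t1 := letter_eq_of_mirror (a := 0) (b := m - 1) ht (by omega)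
        (hodd _ (by omega) (by omega)) rfl
      have t2 := letter_eq_of_mirror (a := 2) (b := m - 3) ht (by omega)
        (hodd _ (by omega) (by omega)) (hzero _ (by omega) (by omega))
      exact absurd (t1.symm.trans t2) h1
  · exact h.specialForm_of_three_mod_four h0 hne.symm h1.symm hm2 (θ.letter_letter _) hfix
      (fun q hq hq2 => hzero q (by omega) (by omega))
      (fun q hq hq2 => hodd q (by omega) (by omega))
      (fun q hq hq2 => htwo q (by omega) (by omega))
  · exact h.specialForm_of_one_mod_four hne h0.symm h1 hm2 (by omega) hfix rfl
      (fun q hq hq2 => htwo q (by omega) (by omega))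
      (fun q hq hq2 => hodd q (by omega) (by omega))
      (fun q hq hq2 => hzero q (by omega) (by omega))

theorem FullClosure.specialForm_of_shift_two
    (h : FullClosure f m θ) {r : Letter → Letter} (hr : Function.Injective r)
    (hs : ∀ q < m, f q = r (f (q + 2))) : SpecialForm (seg f 0 m) (seg f 0 (2 * m + 2)) := by
  rcases Nat.lt_or_ge m 2 with hm | hm
  · refine h.specialForm_of_shift_one (Equiv.swap (f 0) (f 1)).injective fun q hq => ?_
    obtain rfl : q = 0 := by omega
    rw [Nat.zero_add, Equiv.swap_apply_right]
  · by_cases heq : f (m - 1) = f m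
    · exact h.specialForm_of_shift_two_of_eq hm hr hs heq
    · exact h.specialForm_of_shift_two_of_ne hm hr hs heq

end Shift

/-- Proposition: special forms when `|w_{n+1}| = 2|w_n| + 2`, Assumption A fails,
and consecutive occurrences of images of `w n` overlap with offset 1 or 2. -/
theorem special_forms_two_letter_closure
    (Δ : ℕ → Letter) (Θ : ℕ → AM) (w : ℕ → Word)
    (hw : DirectivePrefixes Δ Θ w) (n : ℕ)
    (hlen : (w (n + 1)).length = 2 * (w n).length + 2)
    (hnA : ¬ AssumptionA (w n) (w (n + 1)))
    (hocc : OccursImageAt (w n) (w (n + 1)) 1 ∨ OccursImageAt (w n) (w (n + 1)) 2) :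
    ∃ i j k : Letter, i ≠ j ∧ j ≠ k ∧ i ≠ k ∧ ∃ l : ℕ, 1 ≤ l ∧
      ((w (n + 1) = rep [i] l ++ rep [j] l ∧ w n = rep [i] (l - 1) ∧
        (∀ v : Word, MissedBetween (w n) (w (n + 1)) v ↔ v = rep [i] l)) ∨
       (w (n + 1) = rep [i, j] l ++ rep [k, i] l ∧ w n = rep [i, j] (l - 1) ++ [i] ∧
        (2 ≤ l → ∀ v : Word,
          MissedBetween (w n) (w (n + 1)) v ↔ v = rep [i, j] l) ∧
        (l = 1 → ∀ v : Word,
          MissedBetween (w n) (w (n + 1)) v ↔ (v = [i, j] ∨ v = [i, j, k]))) ∨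
       (w (n + 1) = rep [i, j] l ++ [i, k] ++ rep [j, k] l ∧ w n = rep [i, j] l ∧
        (∀ v : Word, MissedBetween (w n) (w (n + 1)) v ↔ v = rep [i, j] l ++ [i])) ∨
       (w (n + 1) = [i, j, j, k, k, i, i, j, j, k] ∧ w n = [i, j, j, k] ∧
        (∀ v : Word, MissedBetween (w n) (w (n + 1)) v ↔
          (v = [i, j, j, k, k, i] ∨ v = [i, j, j, k, k, i, i, j]))) ∨
       (w (n + 1) = [i, j, j, k, k, i] ∧ w n = [i, j] ∧
        (∀ v : Word, MissedBetween (w n) (w (n + 1)) v ↔ v = [i, j, j, k])) ∨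
       (w (n + 1) = [i, j, j, i, i, j] ∧ w n = [i, j] ∧
        (∀ v : Word, MissedBetween (w n) (w (n + 1)) v ↔ v = [i, j, j, i])) ∨
       (w (n + 1) = rep [i, j, k, j] l ++ rep [i, k, i, j] l ∧
        w n = rep [i, j, k, j] (l - 1) ++ [i, j, k] ∧
        (∀ v : Word, MissedBetween (w n) (w (n + 1)) v ↔
          v = rep [i, j, k, j] l ++ [i])) ∨
       (w (n + 1) = rep [i, j, k, j] l ++ [i, j, k, i] ++ rep [k, j, k, i] l ∧
        w n = rep [i, j, k, j] l ++ [i] ∧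
        (∀ v : Word, MissedBetween (w n) (w (n + 1)) v ↔
          v = rep [i, j, k, j] l ++ [i, j, k]))) := by
  generalize hm : (w n).length = m at hlen
  have hc := hw.2 n
  have hv := eq_seg_getD (w (n + 1))
  rw [hlen] at hv
  generalize (fun q => (w (n + 1)).getD q 0) = f at hv
  have hpre := hc.1
  rw [hv, prefix_seg_iff] at hpre
  simp only [List.length_append, hm, List.length_singleton] at hpre
  have hu : w n = seg f 0 m := by
    have := hpre.2
    rw [seg_add] at this
    exact (List.append_inj this (by simp [hm])).1
  rw [hpre.2, hv] at hc
  have hp := isPseudopal_prefix hw n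
  rw [hu, isPseudopal_seg_iff] at hp
  rw [hu, hv] at hnA hocc ⊢
  have hfull := fullClosure_of_isPalClosure hp hc hnA
  rcases hocc with h | h
  · obtain ⟨r, hr, h⟩ := exists_shift_of_occursImageAt hp h
    exact hfull.specialForm_of_shift_one hr h
  · obtain ⟨r, hr, h⟩ := exists_shift_of_occursImageAt hp h
    exact hfull.specialForm_of_shift_two hr h
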